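/- Fix integers n > k ≥ 1 and K = k(n−k+1). For every (K,k) Dyck path D, every admissible small tuple s for D, and every π ∈ WPF(D,s), one has hdinv(F(π)) = tdinv_small(π), where tdinv_small(π) is the number of attacking ordered pairs (a,b) of small boxes of π with label(a) < label(b). -/

import Mathlib

open scoped Classical
open Finset

noncomputable section

/-- A `(K, k)` Dyck path, encoded by cumulative column heights: `H i` is the number
of north steps taken before the `i`-th east step (equivalently, the number of north
steps in columns `0, …, i-1`), normalized so that `H i = K` for `i ≥ k`.  The path
runs from `(0,0)` to `(k, K)` and stays weakly above the line segment from `(0,0)`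
to `(k, K)`. -/
def IsDyck (K k : ℕ) (H : ℕ → ℕ) : Prop :=
  H 0 = 0 ∧ Monotone H ∧ (∀ i, k ≤ i → H i = K) ∧ ∀ i, i ≤ k → K * i ≤ k * H i

/-- The labeled boxes of the path `H`: the boxes immediately to the right of its
north steps (indexed by lower-left corners `(column, height)`). -/
def boxesD (K k : ℕ) (H : ℕ → ℕ) : Finset (ℕ × ℕ) :=
  (range k ×ˢ range K).filter fun B => H B.1 ≤ B.2 ∧ B.2 < H (B.1 + 1)

/-- The diagonal index of a box, for diagonals of slope `c = K / k`. -/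
def diagIdx (c : ℕ) (B : ℕ × ℕ) : ℤ := (B.2 : ℤ) - (c : ℤ) * (B.1 : ℤ)

/-- `(A, B)` is an attacking (ordered) pair of boxes: `A` and `B` on the same
diagonal with `A` strictly to the left, or `A` one diagonal below `B` and strictly
to its right. -/
def Attack (c : ℕ) (A B : ℕ × ℕ) : Prop :=
  (diagIdx c A = diagIdx c B ∧ A.1 < B.1) ∨
    (diagIdx c A = diagIdx c B - 1 ∧ B.1 < A.1)

/-- The attacking pairs among boxes of `S`. -/
def attackPairsOn (c : ℕ) (S : Finset (ℕ × ℕ)) : Finset ((ℕ × ℕ) × (ℕ × ℕ)) :=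
  (S ×ˢ S).filter fun p => Attack c p.1 p.2

/-- The number of attacking pairs among boxes of `S` whose labels increase
(`tdinv`). -/
def tdinvOn (c : ℕ) (S : Finset (ℕ × ℕ)) (L : ℕ × ℕ → ℕ) : ℕ :=
  ((S ×ˢ S).filter fun p => Attack c p.1 p.2 ∧ L p.1 < L p.2).card

/-- A word parking function of shape `H`: positive labels on the labeled boxes,
strictly increasing up each maximal run of north steps (= each column). -/
def IsWordPF (K k : ℕ) (H : ℕ → ℕ) (L : ℕ × ℕ → ℕ) : Prop :=
  (∀ B ∈ boxesD K k H, 1 ≤ L B) ∧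
  ∀ i y, i < k → H i ≤ y → y + 1 < H (i + 1) → L (i, y) < L (i, y + 1)

/-- `maxtdinv` of the path `H`: the maximum of `tdinv` over all word parking
functions of shape `H`. -/
def maxtdinvD (c K k : ℕ) (H : ℕ → ℕ) : ℕ :=
  sSup {m : ℕ | ∃ L : ℕ × ℕ → ℕ, IsWordPF K k H L ∧ tdinvOn c (boxesD K k H) L = m}

/-- The arm of a box strictly above the path: the number of boxes above the path
strictly to its right in its row. -/
def armD (k : ℕ) (H : ℕ → ℕ) (B : ℕ × ℕ) : ℕ :=
  ((Finset.Ioo B.1 k).filter fun j => H (j + 1) ≤ B.2).card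

/-- The leg of a box strictly above the path: the number of boxes above the path
strictly below it in its column. -/
def legD (H : ℕ → ℕ) (B : ℕ × ℕ) : ℕ := B.2 - H (B.1 + 1)

/-- `pathdinv` of the path: the number of boxes `B` strictly above the path with
`arm B / (leg B + 1) ≤ k / K < (arm B + 1) / leg B`. -/
def pathdinvD (K k : ℕ) (H : ℕ → ℕ) : ℕ :=
  ((range k ×ˢ range K).filter fun B =>
    H (B.1 + 1) ≤ B.2 ∧ armD k H B * K ≤ k * (legD H B + 1) ∧
      k * legD H B < (armD k H B + 1) * K).card

/-- A big tuple `b` for the path `H`: `b i` is at most the number of north steps in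
column `i`, `∑ b i = K - n`, normalized by `b i = 0` for `i ≥ k`. -/
def IsBigTuple (n k : ℕ) (H b : ℕ → ℕ) : Prop :=
  (∀ i, i < k → b i ≤ H (i + 1) - H i) ∧
  (∑ i ∈ range k, b i = k * (n - k + 1) - n) ∧ ∀ i, k ≤ i → b i = 0

/-- Admissibility: `b i ≤ n - k` for all `i`. -/
def AdmissibleB (n k : ℕ) (b : ℕ → ℕ) : Prop := ∀ i, i < k → b i ≤ n - k

/-- The big boxes of `(H, b)`: the top `b i` labeled boxes of column `i`. -/
def bigBoxes (K k : ℕ) (H b : ℕ → ℕ) : Finset (ℕ × ℕ) :=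
  (range k ×ˢ range K).filter fun B =>
    H B.1 ≤ B.2 ∧ H (B.1 + 1) - b B.1 ≤ B.2 ∧ B.2 < H (B.1 + 1)

/-- The small boxes of `(H, b)`: the remaining labeled boxes. -/
def smallBoxes (K k : ℕ) (H b : ℕ → ℕ) : Finset (ℕ × ℕ) :=
  (range k ×ˢ range K).filter fun B =>
    H B.1 ≤ B.2 ∧ B.2 < H (B.1 + 1) - b B.1

/-- The data of a candidate `(K, k)` rational parking function on small boxes:
a path `H`, a big tuple `b`, and a labeling `L` of the small boxes. -/
structure RatData where
  H : ℕ → ℕ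
  b : ℕ → ℕ
  L : ℕ × ℕ → ℕ

/-- The data of a candidate word stacked parking function: stack column counts `w`,
a path `H` (cumulative column heights), and a labeling `L`. -/
structure StackData where
  w : ℕ → ℕ
  H : ℕ → ℕ
  L : ℕ × ℕ → ℕ

/-- A labeling of the small boxes of `(H, b)`: positive labels, strictly increasing
up each column, normalized to `0` off the small boxes. -/
def IsSmallLab (K k : ℕ) (H b : ℕ → ℕ) (L : ℕ × ℕ → ℕ) : Prop :=
  (∀ B ∈ smallBoxes K k H b, 1 ≤ L B) ∧
  (∀ i y, i < k → H i ≤ y → y + 1 < H (i + 1) - b i → L (i, y) < L (i, y + 1)) ∧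
  ∀ B, B ∉ smallBoxes K k H b → L B = 0

/-- An element of `WPF(D, s)` for some `(K, k)` Dyck path `D` and some admissible
small tuple `s` (equivalently, admissible big tuple `b`). -/
def IsRatPF (n k : ℕ) (P : RatData) : Prop :=
  IsDyck (k * (n - k + 1)) k P.H ∧ IsBigTuple n k P.H P.b ∧
    AdmissibleB n k P.b ∧ IsSmallLab (k * (n - k + 1)) k P.H P.b P.L

/-- A word stacked parking function in the `n × k` grid: a stack with `w j ≥ 1`
boxes in column `j` (one stack box per row, at least one per column, each box
weakly right of the box below), a north-east path from `(0,0)` to `(k, n)` lying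
weakly above all boxes of the stack, and positive labels on the boxes right of its
north steps, strictly increasing up each column; all data normalized outside the
grid. -/
def IsStackPF (n k : ℕ) (Q : StackData) : Prop :=
  (∀ j, j < k → 1 ≤ Q.w j) ∧ (∑ j ∈ range k, Q.w j = n) ∧ (∀ j, k ≤ j → Q.w j = 0) ∧
  Q.H 0 = 0 ∧ Monotone Q.H ∧ (∀ j, k ≤ j → Q.H j = n) ∧
  (∀ j, j < k → (∑ t ∈ range (j + 1), Q.w t) ≤ Q.H (j + 1)) ∧
  (∀ B ∈ boxesD n k Q.H, 1 ≤ Q.L B) ∧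
  (∀ j y, j < k → Q.H j ≤ y → y + 1 < Q.H (j + 1) → Q.L (j, y) < Q.L (j, y + 1)) ∧
  ∀ B, B ∉ boxesD n k Q.H → Q.L B = 0

/-- The cumulative column heights of the stacked path obtained by deleting the
north steps adjacent to big boxes: column `t` keeps `s t = v t - b t` north
steps. -/
def stackH (k : ℕ) (H b : ℕ → ℕ) : ℕ → ℕ := fun j =>
  ∑ t ∈ range (min j k), (H (t + 1) - H t - b t)

/-- The map `F`: delete the north steps adjacent to big boxes (keeping the small
boxes with their labels) and take the stack with `w j = n - k + 1 - b j` boxes in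
column `j`. -/
def Fmap (n k : ℕ) (P : RatData) : StackData where
  w := fun j => if j < k then n - k + 1 - P.b j else 0
  H := stackH k P.H P.b
  L := fun B =>
    if B.1 < k ∧ stackH k P.H P.b B.1 ≤ B.2 ∧ B.2 < stackH k P.H P.b (B.1 + 1) then
      P.L (B.1, B.2 + P.H B.1 - stackH k P.H P.b B.1)
    else 0

/-- `hdinv` of a stacked parking function `Q`: insert `w j - 1` empty columns to
the right of column `j` for each `j` (so that column `j` moves to column
`w 0 + ⋯ + w (j-1)` of the `n × n` grid), and count the attacking ordered pairs of
labeled boxes of the resulting `(n, n)` word parking function (with respect to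
diagonals of slope `1`) whose labels increase. -/
def hdinv (n k : ℕ) (Q : StackData) : ℕ :=
  ((boxesD n k Q.H ×ˢ boxesD n k Q.H).filter fun p =>
    Attack 1 ((∑ t ∈ range p.1.1, Q.w t), p.1.2) ((∑ t ∈ range p.2.1, Q.w t), p.2.2) ∧
      Q.L p.1 < Q.L p.2).card

/-- Deleting the big boxes lowers the path by the number of big boxes to the left. -/
theorem stackH_add_sum {k : ℕ} {H b : ℕ → ℕ} (h0 : H 0 = 0) (hH : Monotone H)
    (hb : ∀ i, i < k → b i ≤ H (i + 1) - H i) {j : ℕ} (hj : j ≤ k) :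
    stackH k H b j + ∑ t ∈ range j, b t = H j := by
  rw [stackH, min_eq_left hj]
  induction j with
  | zero => simp [h0]
  | succ j ih =>
    have := ih (by omega)
    have := hb j (by omega)
    have := hH (Nat.le_succ j)
    simp only [Finset.sum_range_succ, Nat.succ_eq_add_one] at *
    omega

theorem stackH_mono {k : ℕ} {H b : ℕ → ℕ} : Monotone (stackH k H b) := fun _ _ h =>
  Finset.sum_le_sum_of_subset (Finset.range_subset_range.2 (min_le_min_right k h))

theorem sum_Fmap_w_add_sum {n k : ℕ} {P : RatData} (hb : AdmissibleB n k P.b) {j : ℕ}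
    (hj : j ≤ k) :
    ∑ t ∈ range j, (Fmap n k P).w t + ∑ t ∈ range j, P.b t = (n - k + 1) * j := by
  rw [← Finset.sum_add_distrib, mul_comm, ← smul_eq_mul]
  nth_rw 2 [← Finset.card_range j]
  rw [← Finset.sum_const]
  refine Finset.sum_congr rfl fun t ht => ?_
  have htk : t < k := (Finset.mem_range.1 ht).trans_le hj
  have := hb t htk
  simp only [Fmap, if_pos htk]
  omega

/-- Inserting the empty columns preserves the left-to-right order of the columns. -/
theorem sum_Fmap_w_lt_iff {n k : ℕ} {P : RatData} (hb : AdmissibleB n k P.b) {i j : ℕ}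
    (hi : i < k) (hj : j < k) :
    ∑ t ∈ range i, (Fmap n k P).w t < ∑ t ∈ range j, (Fmap n k P).w t ↔ i < j := by
  have key : ∀ {i j : ℕ}, i < j → j < k →
      ∑ t ∈ range i, (Fmap n k P).w t < ∑ t ∈ range j, (Fmap n k P).w t := by
    intro i j hij hj
    refine Finset.sum_lt_sum_of_subset (i := i) (Finset.range_subset_range.2 hij.le)
      (by simpa using hij) (by simp) ?_ (fun _ _ _ => Nat.zero_le _)
    have := hb i (hij.trans hj)
    simp only [Fmap, if_pos (hij.trans hj)]
    omega
  refine ⟨fun h => ?_, fun h => key h hj⟩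
  by_contra hij
  rcases (not_lt.1 hij).eq_or_lt with rfl | h'
  · exact lt_irrefl _ h
  · exact lt_asymm h (key h' hi)

/-- Raising column `i` of the stacked path by the number of big boxes to its left sends its
labeled boxes to the small boxes. -/
theorem mem_smallBoxes_iff {n k : ℕ} (hk : 1 ≤ k) (hnk : k < n) {P : RatData}
    (hD : IsDyck (k * (n - k + 1)) k P.H) (hb : IsBigTuple n k P.H P.b) (i y : ℕ) :
    (i, y + ∑ t ∈ range i, P.b t) ∈ smallBoxes (k * (n - k + 1)) k P.H P.b ↔
      (i, y) ∈ boxesD n k (Fmap n k P).H := by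
  obtain ⟨h0, hH, hK, -⟩ := hD
  obtain ⟨hv, hs, -⟩ := hb
  have hnK : n ≤ k * (n - k + 1) := by
    obtain ⟨d, rfl⟩ := Nat.exists_eq_add_of_lt hnk
    obtain ⟨e, rfl⟩ := Nat.exists_eq_add_of_le hk
    rw [show 1 + e + d + 1 - (1 + e) = d + 1 by omega]
    nlinarith [Nat.zero_le (e * d)]
  simp only [smallBoxes, boxesD, Finset.mem_filter, Finset.mem_product, Finset.mem_range]
  simp only [Fmap]
  have hkk := stackH_add_sum h0 hH hv le_rfl
  rw [hs, hK k le_rfl] at hkk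
  by_cases hi : i < k
  · have e1 := stackH_add_sum h0 hH hv hi.le
    have e2 := stackH_add_sum h0 hH hv (Nat.succ_le_of_lt hi)
    have m1 := stackH_mono (k := k) (H := P.H) (b := P.b) (Nat.succ_le_of_lt hi)
    have m2 := hH (Nat.succ_le_of_lt hi)
    rw [hK k le_rfl] at m2
    simp only [Finset.sum_range_succ, Nat.succ_eq_add_one] at e2 m1 m2
    omega
  · simp [hi]

/-- for every `(K, k)` Dyck path `D`, admissible small tuple `s`, and
`π ∈ WPF(D, s)`, one has `hdinv (F π) = tdinv_small π`. -/
theorem stmt11 (n k : ℕ) (hk : 1 ≤ k) (hnk : k < n) (P : RatData)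
    (hP : IsRatPF n k P) :
    hdinv n k (Fmap n k P) =
      tdinvOn (n - k + 1) (smallBoxes (k * (n - k + 1)) k P.H P.b) P.L := by
  obtain ⟨hD, hb, ha, -⟩ := hP
  have hmem := mem_smallBoxes_iff hk hnk hD hb
  have hL : ∀ i y, (i, y) ∈ boxesD n k (Fmap n k P).H →
      (Fmap n k P).L (i, y) = P.L (i, y + ∑ t ∈ range i, P.b t) := by
    intro i y h
    simp only [boxesD, Finset.mem_filter, Finset.mem_product, Finset.mem_range] at h
    have e := stackH_add_sum hD.1 hD.2.1 hb.1 h.1.1.le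
    simp only [Fmap] at h ⊢
    rw [if_pos ⟨h.1.1, h.2⟩]
    congr 2
    omega
  have hA : ∀ i y j z, i < k → j < k →
      (Attack 1 (∑ t ∈ range i, (Fmap n k P).w t, y) (∑ t ∈ range j, (Fmap n k P).w t, z) ↔
        Attack (n - k + 1) (i, y + ∑ t ∈ range i, P.b t) (j, z + ∑ t ∈ range j, P.b t)) := by
    have hdiag : ∀ i y, i < k → diagIdx 1 (∑ t ∈ range i, (Fmap n k P).w t, y) =
        diagIdx (n - k + 1) (i, y + ∑ t ∈ range i, P.b t) := by
      intro i y hi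
      have := congrArg (Nat.cast : ℕ → ℤ) (sum_Fmap_w_add_sum ha hi.le)
      rw [Nat.cast_add, Nat.cast_mul] at this
      rw [diagIdx, diagIdx, ← this, Nat.cast_add, Nat.cast_one]
      ring
    intro i y j z hi hj
    rw [Attack, Attack, hdiag i y hi, hdiag j z hj, sum_Fmap_w_lt_iff ha hi hj,
      sum_Fmap_w_lt_iff ha hj hi]
  have hlt : ∀ i y, (i, y) ∈ boxesD n k (Fmap n k P).H → i < k := fun i y h => by
    simp only [boxesD, Finset.mem_filter, Finset.mem_product, Finset.mem_range] at h
    exact h.1.1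
  have hsurj : ∀ B ∈ smallBoxes (k * (n - k + 1)) k P.H P.b,
      ∃ y, B = (B.1, y + ∑ t ∈ range B.1, P.b t) := by
    intro B hB
    simp only [smallBoxes, Finset.mem_filter, Finset.mem_product, Finset.mem_range] at hB
    have e := stackH_add_sum hD.1 hD.2.1 hb.1 hB.1.1.le
    exact ⟨B.2 - ∑ t ∈ range B.1, P.b t, Prod.ext rfl (by dsimp only; omega)⟩
  refine Finset.card_bij
    (fun p _ => ((p.1.1, p.1.2 + ∑ t ∈ range p.1.1, P.b t),
      (p.2.1, p.2.2 + ∑ t ∈ range p.2.1, P.b t))) ?_ ?_ ?_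
  · rintro ⟨⟨i, y⟩, j, z⟩ h
    simp only [Finset.mem_filter, Finset.mem_product] at h ⊢
    obtain ⟨⟨h1, h2⟩, h3, h4⟩ := h
    rw [hL _ _ h1, hL _ _ h2] at h4
    exact ⟨⟨(hmem i y).2 h1, (hmem j z).2 h2⟩, (hA _ _ _ _ (hlt _ _ h1) (hlt _ _ h2)).1 h3, h4⟩
  · rintro ⟨⟨i, y⟩, j, z⟩ - ⟨⟨i', y'⟩, j', z'⟩ - h
    simp only [Prod.mk.injEq] at h ⊢
    obtain ⟨⟨rfl, h1⟩, rfl, h2⟩ := h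
    omega
  · rintro ⟨B, C⟩ h
    simp only [Finset.mem_filter, Finset.mem_product] at h
    obtain ⟨⟨h1, h2⟩, h3, h4⟩ := h
    obtain ⟨y, hy⟩ := hsurj B h1
    obtain ⟨z, hz⟩ := hsurj C h2
    rw [hy] at h1 h3 h4
    rw [hz] at h2 h3 h4
    have h1' := (hmem _ _).1 h1
    have h2' := (hmem _ _).1 h2
    refine ⟨((B.1, y), (C.1, z)), ?_, Prod.ext hy.symm hz.symm⟩
    simp only [Finset.mem_filter, Finset.mem_product]
    rw [hL _ _ h1', hL _ _ h2']
    exact ⟨⟨h1', h2'⟩, (hA _ _ _ _ (hlt _ _ h1') (hlt _ _ h2')).2 h3, h4⟩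

end
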